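/- Let G be a finite simple graph with at least one edge, with no K_6-minor, and such that every edge incident to a vertex of degree at most 7 belongs to at least 4 triangles. Then for every vertex u of degree at most 7, every vertex v ∈ N(u) has a neighbor in G \ N[u]. -/

import Mathlib

open SimpleGraph

/-- `H` is a minor of `G`: there is a family of nonempty, pairwise disjoint,
connected branch sets in `G`, one for each vertex of `H`, with an edge of `G`
between the branch sets corresponding to each edge of `H`. -/
def SimpleGraph.MinorOf {W V : Type} (H : SimpleGraph W) (G : SimpleGraph V) : Prop :=
  ∃ f : W → Set V,
    (∀ w, (f w).Nonempty) ∧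
    (∀ w, (G.induce (f w)).Connected) ∧
    (∀ w₁ w₂, w₁ ≠ w₂ → Disjoint (f w₁) (f w₂)) ∧
    (∀ w₁ w₂, H.Adj w₁ w₂ → ∃ v₁ ∈ f w₁, ∃ v₂ ∈ f w₂, G.Adj v₁ v₂)

/-- Six vertices `p, p', q, q', r, s` such that `{p, p'}`, `{q, q'}`, `{r}` and `{s}` are the
branch sets of a complete minor on four vertices; `p = p'` and `q = q'` are allowed. -/
def IsFourModel {V : Type} (G : SimpleGraph V) (p p' q q' r s : V) : Prop :=
  (p = p' ∨ G.Adj p p') ∧ (q = q' ∨ G.Adj q q') ∧ G.Adj r s ∧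
  (p ≠ q ∧ p ≠ q' ∧ p' ≠ q ∧ p' ≠ q') ∧
  (p ≠ r ∧ p' ≠ r ∧ q ≠ r ∧ q' ≠ r) ∧ (p ≠ s ∧ p' ≠ s ∧ q ≠ s ∧ q' ≠ s) ∧
  (G.Adj p q ∨ G.Adj p q' ∨ G.Adj p' q ∨ G.Adj p' q') ∧
  (G.Adj p r ∨ G.Adj p' r) ∧ (G.Adj p s ∨ G.Adj p' s) ∧
  (G.Adj q r ∨ G.Adj q' r) ∧ (G.Adj q s ∨ G.Adj q' s)

lemma connected_induce_singleton {V : Type} (G : SimpleGraph V) (v : V) :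
    (G.induce ({v} : Set V)).Connected :=
  Connected.of_subsingleton

lemma connected_induce_pair_of_eq_or_adj {V : Type} (G : SimpleGraph V) {p q : V}
    (h : p = q ∨ G.Adj p q) : (G.induce ({p, q} : Set V)).Connected := by
  rcases h with rfl | h
  · rw [Set.pair_eq_singleton]
    exact connected_induce_singleton G p
  · exact induce_pair_connected_of_adj h

lemma top_six_minorOf_of_isFourModel {V : Type} {G : SimpleGraph V} {u v p p' q q' r s : V}
    (huv : G.Adj u v) (hu : ∀ z ∈ ({p, p', q, q', r, s} : Set V), G.Adj u z)
    (hv : ∀ z ∈ ({p, p', q, q', r, s} : Set V), G.Adj v z)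
    (h : IsFourModel G p p' q q' r s) : (⊤ : SimpleGraph (Fin 6)).MinorOf G := by
  obtain ⟨hp, hq, hrs, hpq, hr, hs, apq, apr, aps, aqr, aqs⟩ := h
  simp only [Set.mem_insert_iff, Set.mem_singleton_iff, forall_eq_or_imp, forall_eq] at hu hv
  have hlt : ∀ i j : Fin 6, i < j →
      Disjoint ((![{u}, {v}, {p, p'}, {q, q'}, {r}, {s}] : Fin 6 → Set V) i)
        ((![{u}, {v}, {p, p'}, {q, q'}, {r}, {s}] : Fin 6 → Set V) j) ∧
      ∃ v₁ ∈ (![{u}, {v}, {p, p'}, {q, q'}, {r}, {s}] : Fin 6 → Set V) i,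
      ∃ v₂ ∈ (![{u}, {v}, {p, p'}, {q, q'}, {r}, {s}] : Fin 6 → Set V) j, G.Adj v₁ v₂ := by
    have ne : ∀ {x y : V}, G.Adj x y → x ≠ y := fun h => h.ne
    intro i j hij
    fin_cases i <;> fin_cases j <;> first
      | (exfalso; revert hij; decide)
      | (simp [Set.disjoint_left]; grind)
  refine ⟨![{u}, {v}, {p, p'}, {q, q'}, {r}, {s}], ?_, ?_, ?_, ?_⟩
  · intro i; fin_cases i <;> simp
  · intro i
    fin_cases i
    · exact connected_induce_singleton G u
    · exact connected_induce_singleton G v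
    · exact connected_induce_pair_of_eq_or_adj G hp
    · exact connected_induce_pair_of_eq_or_adj G hq
    · exact connected_induce_singleton G r
    · exact connected_induce_singleton G s
  · intro i j hij
    rcases lt_or_gt_of_ne hij with h | h
    · exact (hlt i j h).1
    · exact (hlt j i h).1.symm
  · intro i j hij
    rcases lt_or_gt_of_ne hij.ne with h | h
    · exact (hlt i j h).2
    · obtain ⟨x, hx, y, hy, hxy⟩ := (hlt j i h).2
      exact ⟨y, hy, x, hx, hxy.symm⟩

set_option maxRecDepth 100000 in
lemma four_model_cases_of_six_vertices : ∀ ab ac bc ax bx cx ay b_y cy wx wy xy : Bool,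
    3 ≤ 1 + ab.toNat + ac.toNat + ax.toNat + ay.toNat →
    3 ≤ 1 + ab.toNat + bc.toNat + bx.toNat + b_y.toNat →
    3 ≤ 1 + ac.toNat + bc.toNat + cx.toNat + cy.toNat →
    3 ≤ wx.toNat + ax.toNat + bx.toNat + cx.toNat + xy.toNat →
    3 ≤ wy.toNat + ay.toNat + b_y.toNat + cy.toNat + xy.toNat →
    ((ax && b_y) && (ab || ay || bx || xy) && (ac || cx) && (bc || cy)) ||
    ((ay && bx) && (ab || ax || b_y || xy) && (ac || cy) && (bc || cx)) ||
    (ab && xy && (ax || ay || bx || b_y) && (ac || bc) && (wx || wy) && (cx || cy)) ||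
    (xy && bc && (wx || wy || ax || ay) && (bx || b_y) && (cx || cy)) ||
    (xy && ac && (wx || wy || bx || b_y) && (ax || ay) && (cx || cy)) ||
    (cx && ab && (ac || ax) && (bc || bx)) ||
    (b_y && (bc || cy) && ab && ay && (wy || cy)) ||
    (wx && ax && bx && ab) ||
    (ab && ac && bc) ||
    (wx && ax && cx && ac) ||
    (wx && bx && cx && bc) := by
  decide

lemma four_model_cases_of_five_vertices : ∀ ab ac bc ax bx cx wx : Bool,
    3 ≤ 1 + ab.toNat + ac.toNat + ax.toNat →
    3 ≤ 1 + ab.toNat + bc.toNat + bx.toNat →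
    3 ≤ 1 + ac.toNat + bc.toNat + cx.toNat →
    3 ≤ wx.toNat + ax.toNat + bx.toNat + cx.toNat →
    (ax && bc && (ab || bx) && (ac || cx)) || (bx && ac && (ab || ax) && (bc || cx)) := by
  decide

lemma insert_six_subset {V : Type} {L : Finset V} {p p' q q' r s : V} (hp : p ∈ L)
    (hp' : p' ∈ L) (hq : q ∈ L) (hq' : q' ∈ L) (hr : r ∈ L) (hs : s ∈ L) :
    ({p, p', q, q', r, s} : Set V) ⊆ L := by
  simp [Set.insert_subset_iff, *]

/-- A nonempty set of at most six vertices inducing a subgraph of minimum degree at least three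
contains the branch sets of a complete minor on four vertices. -/
lemma exists_isFourModel_of_three_le_degree {V : Type} [DecidableEq V] (G : SimpleGraph V)
    [DecidableRel G.Adj] (L : Finset V) (hne : L.Nonempty) (hL : L.card ≤ 6)
    (hdeg : ∀ z ∈ L, 3 ≤ (L.filter (G.Adj z)).card) :
    ∃ p p' q q' r s, ({p, p', q, q', r, s} : Set V) ⊆ L ∧ IsFourModel G p p' q q' r s := by
  have hsum : ∀ z ∈ L, 3 ≤ ∑ y ∈ L, (decide (G.Adj z y)).toNat := by
    intro z hz
    refine (hdeg z hz).trans_eq ?_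
    rw [Finset.card_filter]
    refine Finset.sum_congr rfl fun y _ => ?_
    by_cases h : G.Adj z y <;> simp [h]
  obtain ⟨w, hw⟩ := hne
  obtain ⟨a, ha, b, hb, c, hc, hab, hac, hbc⟩ := Finset.two_lt_card.1 (hdeg w hw)
  rw [Finset.mem_filter] at ha hb hc
  obtain ⟨ha, hwa⟩ := ha
  obtain ⟨hb, hwb⟩ := hb
  obtain ⟨hc, hwc⟩ := hc
  have nwa := hwa.ne
  have nwb := hwb.ne
  have nwc := hwc.ne
  have hT : ({w, a, b, c} : Finset V) ⊆ L := by
    simp [Finset.insert_subset_iff, *]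
  have hTc : ({w, a, b, c} : Finset V).card = 4 := by
    simp [*]
  obtain ⟨S, hS⟩ : ∃ S, S = L \ {w, a, b, c} := ⟨_, rfl⟩
  have hLS : L = {w, a, b, c} ∪ S := by rw [hS, Finset.union_sdiff_of_subset hT]
  have hdisj : ∀ z ∈ S, z ≠ w ∧ z ≠ a ∧ z ≠ b ∧ z ≠ c := by
    intro z hz
    rw [hS] at hz
    simpa using (Finset.mem_sdiff.1 hz).2
  have hSc : S.card ≤ 2 := by
    have := Finset.card_sdiff_add_card_eq_card hT
    rw [← hS] at this
    omega
  obtain h0 | h1 | h2 : S.card = 0 ∨ S.card = 1 ∨ S.card = 2 := by omega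
  · rw [Finset.card_eq_zero] at h0
    have hL' : L = {w, a, b, c} := by simp [hLS, h0]
    have da := hsum a ha
    have db := hsum b hb
    rw [hL'] at da db
    simp only [Finset.sum_insert, Finset.mem_insert, Finset.mem_singleton, Finset.sum_singleton,
      nwa, nwb, nwc, hab, hac, hbc, or_self, not_false_eq_true, G.loopless.irrefl, hwa.symm,
      hwb.symm, G.adj_comm b a] at da db
    refine ⟨a, a, w, w, b, c, insert_six_subset ha ha hw hw hb hc, ?_⟩
    have hG := fun x y => G.adj_comm x y
    unfold IsFourModel
    by_cases e1 : G.Adj a b <;> by_cases e2 : G.Adj a c <;> by_cases e3 : G.Adj b c <;>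
      simp [e1, e2, e3] at da db
    grind
  · obtain ⟨x, rfl⟩ := Finset.card_eq_one.1 h1
    obtain ⟨xw, xa, xb, xc⟩ := hdisj x (by simp)
    have hL' : L = {w, a, b, c, x} := by rw [hLS]; ext; simp
    have hx : x ∈ L := by simp [hL']
    have da := hsum a ha
    have db := hsum b hb
    have dc := hsum c hc
    have dx := hsum x hx
    rw [hL'] at da db dc dx
    simp only [Finset.sum_insert, Finset.mem_insert, Finset.mem_singleton, Finset.sum_singleton,
      nwa, nwb, nwc, hab, hac, hbc, xw.symm, xa.symm, xb.symm, xc.symm, or_self,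
      not_false_eq_true, G.loopless.irrefl, hwa.symm, hwb.symm, hwc.symm,
      G.adj_comm b a, G.adj_comm c a, G.adj_comm c b, G.adj_comm x w, G.adj_comm x a,
      G.adj_comm x b, G.adj_comm x c, decide_true, decide_false, Bool.toNat_true,
      Bool.toNat_false] at da db dc dx
    have key := four_model_cases_of_five_vertices (decide (G.Adj a b)) (decide (G.Adj a c))
      (decide (G.Adj b c)) (decide (G.Adj a x)) (decide (G.Adj b x)) (decide (G.Adj c x))
      (decide (G.Adj w x)) (by omega) (by omega) (by omega) (by omega)
    simp only [Bool.or_eq_true, Bool.and_eq_true, decide_eq_true_eq] at key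
    have hG := fun x y => G.adj_comm x y
    rcases key with h | h
    · refine ⟨a, x, w, w, b, c, insert_six_subset ha hx hw hw hb hc, ?_⟩
      unfold IsFourModel
      grind
    · refine ⟨b, x, w, w, a, c, insert_six_subset hb hx hw hw ha hc, ?_⟩
      unfold IsFourModel
      grind
  · obtain ⟨x, y, hxy, rfl⟩ := Finset.card_eq_two.1 h2
    obtain ⟨xw, xa, xb, xc⟩ := hdisj x (by simp)
    obtain ⟨yw, ya, yb, yc⟩ := hdisj y (by simp)
    have hL' : L = {w, a, b, c, x, y} := by rw [hLS]; ext; simp; tauto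
    have hx : x ∈ L := by simp [hL']
    have hy : y ∈ L := by simp [hL']
    have da := hsum a ha
    have db := hsum b hb
    have dc := hsum c hc
    have dx := hsum x hx
    have dy := hsum y hy
    rw [hL'] at da db dc dx dy
    simp only [Finset.sum_insert, Finset.mem_insert, Finset.mem_singleton, Finset.sum_singleton,
      nwa, nwb, nwc, hab, hac, hbc, hxy, xw.symm, xa.symm, xb.symm, xc.symm, yw.symm, ya.symm,
      yb.symm, yc.symm, or_self, not_false_eq_true, G.loopless.irrefl, hwa.symm, hwb.symm,
      hwc.symm, G.adj_comm b a, G.adj_comm c a, G.adj_comm c b, G.adj_comm x w,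
      G.adj_comm x a, G.adj_comm x b, G.adj_comm x c, G.adj_comm y w, G.adj_comm y a,
      G.adj_comm y b, G.adj_comm y c, G.adj_comm y x, decide_true, decide_false,
      Bool.toNat_true, Bool.toNat_false] at da db dc dx dy
    have key := four_model_cases_of_six_vertices (decide (G.Adj a b)) (decide (G.Adj a c))
      (decide (G.Adj b c)) (decide (G.Adj a x)) (decide (G.Adj b x)) (decide (G.Adj c x))
      (decide (G.Adj a y)) (decide (G.Adj b y)) (decide (G.Adj c y)) (decide (G.Adj w x))
      (decide (G.Adj w y)) (decide (G.Adj x y)) (by omega) (by omega) (by omega) (by omega)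
      (by omega)
    simp only [Bool.or_eq_true, Bool.and_eq_true, decide_eq_true_eq] at key
    have hG := fun x y => G.adj_comm x y
    clear hdeg hsum hLS hL' hdisj da db dc dx dy hT hTc hS h2 hSc hL
    rcases key with (((((((((h | h) | h) | h) | h) | h) | h) | h) | h) | h) | h
    · refine ⟨a, x, b, y, w, c, insert_six_subset ha hx hb hy hw hc, ?_⟩
      unfold IsFourModel; grind
    · refine ⟨a, y, b, x, w, c, insert_six_subset ha hy hb hx hw hc, ?_⟩
      unfold IsFourModel; grind
    · refine ⟨a, b, x, y, w, c, insert_six_subset ha hb hx hy hw hc, ?_⟩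
      unfold IsFourModel; grind
    · refine ⟨w, a, x, y, b, c, insert_six_subset hw ha hx hy hb hc, ?_⟩
      unfold IsFourModel; grind
    · refine ⟨w, b, x, y, a, c, insert_six_subset hw hb hx hy ha hc, ?_⟩
      unfold IsFourModel; grind
    · refine ⟨c, x, w, w, a, b, insert_six_subset hc hx hw hw ha hb, ?_⟩
      unfold IsFourModel; grind
    · refine ⟨w, c, a, a, b, y, insert_six_subset hw hc ha ha hb hy, ?_⟩
      unfold IsFourModel; grind
    · refine ⟨w, w, x, x, a, b, insert_six_subset hw hw hx hx ha hb, ?_⟩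
      unfold IsFourModel; grind
    · refine ⟨a, a, w, w, b, c, insert_six_subset ha ha hw hw hb hc, ?_⟩
      unfold IsFourModel; grind
    · refine ⟨w, w, x, x, a, c, insert_six_subset hw hw hx hx ha hc, ?_⟩
      unfold IsFourModel; grind
    · refine ⟨w, w, x, x, b, c, insert_six_subset hw hw hx hx hb hc, ?_⟩
      unfold IsFourModel; grind

/-- Let `G` be a finite simple graph with at least one edge, no `K_6`-minor,
such that every edge incident to a vertex of degree at most 7 belongs to at
least 4 triangles.  Then for every vertex `u` of degree at most 7, every
`v ∈ N(u)` has a neighbor outside the closed neighborhood `N[u]`. -/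
theorem statement14 {V : Type} [Fintype V] (G : SimpleGraph V) [DecidableRel G.Adj]
    (hedge : G.edgeSet.Nonempty)
    (hfree : ¬ (⊤ : SimpleGraph (Fin 6)).MinorOf G)
    (htri : ∀ u v : V, G.Adj u v → G.degree u ≤ 7 →
      4 ≤ (G.neighborSet u ∩ G.neighborSet v).ncard) :
    ∀ u : V, G.degree u ≤ 7 → ∀ v ∈ G.neighborSet u,
      ∃ w : V, w ∉ (insert u (G.neighborSet u) : Set V) ∧ G.Adj v w := by
  classical
  intro u hu v hv
  by_contra! hcon
  rw [mem_neighborSet] at hv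
  have hsub : ∀ w, G.Adj v w → w = u ∨ G.Adj u w := by
    intro w hw
    by_contra hn
    exact hcon w (by simpa using hn) hw
  have hdegv : G.degree v ≤ 7 := by
    have hle : G.neighborFinset v ⊆ insert u ((G.neighborFinset u).erase v) := by
      intro w hw
      rw [mem_neighborFinset] at hw
      rcases hsub w hw with rfl | h
      · simp
      · simp [h, hw.ne']
    have h1 := Finset.card_le_card hle
    have h2 := Finset.card_insert_le u ((G.neighborFinset u).erase v)
    have h3 := Finset.card_erase_add_one ((G.mem_neighborFinset u v).2 hv)
    simp only [card_neighborFinset_eq_degree] at h1 h3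
    omega
  obtain ⟨L, hLdef⟩ : ∃ L, L = G.neighborFinset u ∩ G.neighborFinset v := ⟨_, rfl⟩
  have hmem : ∀ z, z ∈ L ↔ G.Adj u z ∧ G.Adj v z := by simp [hLdef]
  have hLcard : 4 ≤ L.card := by
    have h := htri u v hv hu
    rwa [show G.neighborSet u ∩ G.neighborSet v = (L : Set V) by ext; simp [hmem],
      Set.ncard_coe_finset] at h
  have hL6 : L.card ≤ 6 := by
    have hle : L ⊆ (G.neighborFinset u).erase v := by
      intro z hz
      rw [hmem] at hz
      simp [hz.1, hz.2.ne']
    have h1 := Finset.card_le_card hle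
    have h3 := Finset.card_erase_add_one ((G.mem_neighborFinset u v).2 hv)
    simp only [card_neighborFinset_eq_degree] at h3
    omega
  have hdeg : ∀ z ∈ L, 3 ≤ (L.filter (G.Adj z)).card := by
    intro z hz
    have h := htri v z ((hmem z).1 hz).2 hdegv
    have hle : G.neighborSet v ∩ G.neighborSet z ⊆
        (insert u (L.filter (G.Adj z)) : Finset V) := by
      rintro y ⟨hvy, hzy⟩
      rw [mem_neighborSet] at hvy hzy
      rcases hsub y hvy with rfl | huy
      · simp
      · simp [hmem, huy, hvy, hzy]
    have h1 := Set.ncard_le_ncard hle (Finset.finite_toSet _)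
    rw [Set.ncard_coe_finset] at h1
    have h2 := Finset.card_insert_le u (L.filter (G.Adj z))
    omega
  obtain ⟨p, p', q, q', r, s, hsubL, hmodel⟩ := exists_isFourModel_of_three_le_degree G L
    (Finset.card_pos.1 (by omega)) hL6 hdeg
  exact hfree (top_six_minorOf_of_isFourModel hv (fun z hz => ((hmem z).1 (hsubL hz)).1)
    (fun z hz => ((hmem z).1 (hsubL hz)).2) hmodel)
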